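/- Let I ≥ 1 be an integer, let L > 0 and γ > 0 be reals with γ ≤ 1/(√30 · L · I), and let σ², δ², G² ≥ 0 be reals. Suppose e_0, e_1, …, e_I are nonnegative reals with e_0 = 0 and e_{i+1} ≤ (1 + 1/(2I − 1) + 6Iγ²L²)·e_i + γ²σ² + 6Iγ²δ² + 6Iγ²G² for all 0 ≤ i ≤ I − 1. Then e_i ≤ 5Iγ²(σ² + 6Iδ²) + 30I²γ²G² for all 0 ≤ i ≤ I. -/

import Mathlib

/-- Crude unrolling of the affine recursion `e (i + 1) ≤ (1 + a) * e i + c`. -/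
theorem le_mul_pow_of_affine_recursion {a c : ℝ} (ha : 0 ≤ a) (hc : 0 ≤ c) {e : ℕ → ℝ} {n : ℕ}
    (he0 : e 0 ≤ 0) (hrec : ∀ i < n, e (i + 1) ≤ (1 + a) * e i + c) :
    ∀ i ≤ n, e i ≤ c * i * (1 + a) ^ i := by
  intro i
  induction i with
  | zero => simpa using he0
  | succ k ih =>
    intro hk
    have hpow : 1 ≤ (1 + a) ^ (k + 1) := one_le_pow₀ (by linarith)
    calc e (k + 1) ≤ (1 + a) * e k + c := hrec k hk
      _ ≤ (1 + a) * (c * k * (1 + a) ^ k) + c * (1 + a) ^ (k + 1) := by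
        gcongr
        · exact ih (by lia)
        · exact le_mul_of_one_le_right hc hpow
      _ = c * ↑(k + 1) * (1 + a) ^ (k + 1) := by push_cast; ring

theorem exp_six_fifths_le_five : Real.exp (6 / 5) ≤ 5 := by
  refine le_of_pow_le_pow_left₀ (n := 5) (by norm_num) (by norm_num) ?_
  calc Real.exp (6 / 5) ^ 5 = Real.exp 1 ^ 6 := by
        rw [← Real.exp_nat_mul, ← Real.exp_nat_mul]; norm_num
    _ ≤ 3 ^ 6 := by
        gcongr
        linarith [Real.exp_one_lt_d9]
    _ ≤ 5 ^ 5 := by norm_num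


/-- Deterministic skeleton of Lemma A.3.2 (client-drift lemma): if `γ ≤ 1/(√30 L I)` and the
nonnegative sequence `e_0, …, e_I` satisfies `e_0 = 0` and the drift recursion, then
`e_i ≤ 5Iγ²(σ² + 6Iδ²) + 30I²γ²G²` for all `0 ≤ i ≤ I`. -/
theorem client_drift_recursion (I : ℕ) (hI : 1 ≤ I) (L γ : ℝ) (hL : 0 < L) (hγ0 : 0 < γ)
    (hγ : γ ≤ 1 / (Real.sqrt 30 * L * (I : ℝ)))
    (σ2 δ2 G2 : ℝ) (hσ2 : 0 ≤ σ2) (hδ2 : 0 ≤ δ2) (hG2 : 0 ≤ G2)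
    (e : ℕ → ℝ) (he0 : e 0 = 0) (henn : ∀ i ≤ I, 0 ≤ e i)
    (hrec : ∀ i < I,
      e (i + 1) ≤ (1 + 1 / (2 * (I : ℝ) - 1) + 6 * (I : ℝ) * γ ^ 2 * L ^ 2) * e i
        + γ ^ 2 * σ2 + 6 * (I : ℝ) * γ ^ 2 * δ2 + 6 * (I : ℝ) * γ ^ 2 * G2) :
    ∀ i ≤ I, e i ≤ 5 * (I : ℝ) * γ ^ 2 * (σ2 + 6 * (I : ℝ) * δ2)
      + 30 * (I : ℝ) ^ 2 * γ ^ 2 * G2 := by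
  have hI' : (1 : ℝ) ≤ I := by exact_mod_cast hI
  have hstep : 30 * (γ ^ 2 * L ^ 2 * (I : ℝ) ^ 2) ≤ 1 := by
    rw [le_div_iff₀ (by positivity)] at hγ
    calc 30 * (γ ^ 2 * L ^ 2 * (I : ℝ) ^ 2) = (γ * (Real.sqrt 30 * L * I)) ^ 2 := by
          simp only [mul_pow, Real.sq_sqrt (show (0 : ℝ) ≤ 30 by norm_num)]; ring
      _ ≤ 1 := pow_le_one₀ (by positivity) hγ
  have hden : 0 < 2 * (I : ℝ) - 1 := by linarith
  set a : ℝ := 1 / (2 * (I : ℝ) - 1) + 6 * I * γ ^ 2 * L ^ 2 with ha_def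
  have ha : 0 ≤ a := by positivity
  have hIa : I * a ≤ 6 / 5 := by
    have hdiv : (I : ℝ) / (2 * I - 1) ≤ 1 := (div_le_one hden).2 (by linarith)
    have hsplit : I * a = (I : ℝ) / (2 * I - 1) + 6 * (γ ^ 2 * L ^ 2 * (I : ℝ) ^ 2) := by
      rw [ha_def]; ring
    linarith
  have hpow : (1 + a) ^ I ≤ 5 := calc
    (1 + a) ^ I ≤ Real.exp a ^ I := by
      gcongr
      linarith [Real.add_one_le_exp a]
    _ = Real.exp (I * a) := (Real.exp_nat_mul a I).symm
    _ ≤ Real.exp (6 / 5) := Real.exp_le_exp.2 hIa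
    _ ≤ 5 := exp_six_fifths_le_five
  set c : ℝ := γ ^ 2 * σ2 + 6 * I * γ ^ 2 * δ2 + 6 * I * γ ^ 2 * G2 with hc_def
  have hc : 0 ≤ c := by positivity
  intro i hi
  calc e i ≤ c * i * (1 + a) ^ i := by
        refine le_mul_pow_of_affine_recursion ha hc he0.le (fun j hj => ?_) i hi
        linarith [hrec j hj]
    _ ≤ c * I * (1 + a) ^ I := by
        gcongr
        linarith
    _ ≤ c * I * 5 := by gcongr
    _ = _ := by rw [hc_def]; ring
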